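/- Assume the global growth condition: there exist a nonnegative g with ∫₀¹ g(t)² dt < ∞ and a differentiable γ : ℝ₊ → ℝ₊ with γ' ≥ 0 such that max(‖σ(t,x)‖² + 2⟨x, b(t,x)⟩, |σ(t,x)ᵀ x|) ≤ g(t)(γ(|x|²) + 1) for all x ∈ ℝ^d and t ∈ [0,1]. Then for every α > 0, every absolutely continuous l with e(l) ≤ α, every solution h of the controlled equation driven by l, and every t ∈ [0,1], one has the quantitative a priori bound ∫₀^{|h(t)|²} ds/(γ(s)+1) ≤ ∫₀^{|x₀|²} ds/(γ(s)+1) + (1 + 2√α)·(∫₀¹ g(s)² ds)^{1/2}. -/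

import Mathlib

open MeasureTheory Set Metric
open scoped RealInnerProductSpace ENNReal

noncomputable section

/-- Matrix times vector, landing in Euclidean space. -/
def mVec {d m : ℕ} (A : Matrix (Fin d) (Fin m) ℝ)
    (v : EuclideanSpace ℝ (Fin m)) : EuclideanSpace ℝ (Fin d) :=
  (WithLp.equiv 2 (Fin d → ℝ)).symm fun i => ∑ j, A i j * v j

/-- Transposed matrix times vector (`σᵀ x`), landing in Euclidean space. -/
def mVecT {d m : ℕ} (A : Matrix (Fin d) (Fin m) ℝ)
    (x : EuclideanSpace ℝ (Fin d)) : EuclideanSpace ℝ (Fin m) :=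
  (WithLp.equiv 2 (Fin m → ℝ)).symm fun j => ∑ i, A i j * x i

/-- Square of the Frobenius (Hilbert–Schmidt) norm `‖A‖² = ∑ᵢⱼ Aᵢⱼ²`. -/
def frobSq {d m : ℕ} (A : Matrix (Fin d) (Fin m) ℝ) : ℝ :=
  ∑ i, ∑ j, (A i j) ^ 2

/-- An admissible control: `l'` is (a.e. strongly) measurable on `[0,1]` and
`∫₀¹ ‖l'(t)‖² dt < ∞`; `l'` plays the role of the derivative of an absolutely
continuous path `l` with `l(0) = 0`, so that `e(l) = ∫₀¹ ‖l'(t)‖² dt`. -/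
def Adm {m : ℕ} (l' : ℝ → EuclideanSpace ℝ (Fin m)) : Prop :=
  AEStronglyMeasurable l' (volume.restrict (Icc 0 1)) ∧
    IntegrableOn (fun t => ‖l' t‖ ^ 2) (Icc 0 1)

/-- `h` is a solution on `[0,1]` of the controlled equation
`h(t) = x₀ + ∫₀ᵗ b(s, h(s)) ds + ∫₀ᵗ σ(s, h(s)) l'(s) ds` driven by the
absolutely continuous path `l` with derivative `l'`. -/
def IsSol {d m : ℕ} (b : ℝ → EuclideanSpace ℝ (Fin d) → EuclideanSpace ℝ (Fin d))
    (σ : ℝ → EuclideanSpace ℝ (Fin d) → Matrix (Fin d) (Fin m) ℝ)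
    (x₀ : EuclideanSpace ℝ (Fin d)) (l' : ℝ → EuclideanSpace ℝ (Fin m))
    (h : ℝ → EuclideanSpace ℝ (Fin d)) : Prop :=
  ContinuousOn h (Icc 0 1) ∧ ∀ t ∈ Icc (0:ℝ) 1,
    h t = x₀ + ∫ s in (0:ℝ)..t, (b s (h s) + mVec (σ s (h s)) (l' s))


/-- A Lipschitz function of an absolutely continuous function is absolutely continuous. -/
lemma LipschitzOnWith.comp_absolutelyContinuousOnInterval {X Y : Type*} [PseudoMetricSpace X]
    [PseudoMetricSpace Y] {K : NNReal} {φ : X → Y} {s : Set X} {f : ℝ → X} {a b : ℝ}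
    (hφ : LipschitzOnWith K φ s) (hf : AbsolutelyContinuousOnInterval f a b)
    (hs : MapsTo f (uIcc a b) s) :
    AbsolutelyContinuousOnInterval (fun x => φ (f x)) a b := by
  rw [absolutelyContinuousOnInterval_iff] at hf ⊢
  intro ε hε
  obtain ⟨δ, hδ, H⟩ := hf (ε / (K + 1)) (by positivity)
  refine ⟨δ, hδ, fun E hE hlt => ?_⟩
  calc ∑ i ∈ Finset.range E.1, dist (φ (f (E.2 i).1)) (φ (f (E.2 i).2))
      ≤ ∑ i ∈ Finset.range E.1, K * dist (f (E.2 i).1) (f (E.2 i).2) :=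
        Finset.sum_le_sum fun i hi =>
          hφ.dist_le_mul _ (hs (hE.1 i hi).1) _ (hs (hE.1 i hi).2)
    _ = K * ∑ i ∈ Finset.range E.1, dist (f (E.2 i).1) (f (E.2 i).2) :=
        (Finset.mul_sum _ _ _).symm
    _ ≤ (K + 1) * ∑ i ∈ Finset.range E.1, dist (f (E.2 i).1) (f (E.2 i).2) := by
        gcongr
        linarith
    _ < (K + 1) * (ε / (K + 1)) := by
        gcongr
        exact H E hE hlt
    _ = ε := by field_simp

/-- The primitive of an integrable vector-valued function is absolutely continuous. -/
lemma IntervalIntegrable.absolutelyContinuousOnInterval_primitive {E : Type*}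
    [NormedAddCommGroup E] [NormedSpace ℝ E] {f : ℝ → E} {a b : ℝ}
    (hf : IntervalIntegrable f volume a b) :
    AbsolutelyContinuousOnInterval (fun x => ∫ s in a..x, f s) a b := by
  have hF := hf.norm.absolutelyContinuousOnInterval_intervalIntegral (c := a) (by simp)
  rw [absolutelyContinuousOnInterval_iff] at hF ⊢
  intro ε hε
  obtain ⟨δ, hδ, H⟩ := hF ε hε
  refine ⟨δ, hδ, fun E hE hlt => (Finset.sum_le_sum fun i hi => ?_).trans_lt (H E hE hlt)⟩
  have hint : ∀ x ∈ uIcc a b, IntervalIntegrable f volume a x := fun x hx =>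
    hf.mono_set (uIcc_subset_uIcc left_mem_uIcc hx)
  have h1 := hint _ (hE.1 i hi).1
  have h2 := hint _ (hE.1 i hi).2
  rw [dist_eq_norm, Real.dist_eq, intervalIntegral.integral_interval_sub_left h1 h2,
    intervalIntegral.integral_interval_sub_left h1.norm h2.norm]
  exact intervalIntegral.norm_integral_le_abs_integral_norm

/-- A bound on `⟪∇V, f⟫` along the primitive of `f` bounds the growth of `V`. -/
lemma comp_primitive_sub_le_integral {E : Type*} [NormedAddCommGroup E] [NormedSpace ℝ E]
    [FiniteDimensional ℝ E] {V : E → ℝ} (hV : ContDiff ℝ 1 V) {x₀ : E} {f : ℝ → E}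
    {ρ : ℝ → ℝ} {a b : ℝ} (hab : a ≤ b) (hf : IntervalIntegrable f volume a b)
    (hρ : IntervalIntegrable ρ volume a b)
    (hle : ∀ s ∈ Icc a b,
      fderiv ℝ V (x₀ + ∫ r in a..s, f r) (f s) ≤ ρ s) :
    V (x₀ + ∫ r in a..b, f r) - V x₀ ≤ ∫ s in a..b, ρ s := by
  have : ProperSpace E := FiniteDimensional.proper ℝ E
  have : CompleteSpace E := FiniteDimensional.complete ℝ E
  have hP := hf.absolutelyContinuousOnInterval_primitive
  obtain ⟨C, hC⟩ := hP.exists_bound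
  obtain ⟨K, hK⟩ := hV.contDiffOn.exists_lipschitzOnWith (s := closedBall x₀ C)
    (by decide) (convex_closedBall _ _) (isCompact_closedBall _ _)
  have hT : LipschitzWith 1 fun y : E => x₀ + y :=
    LipschitzWith.of_dist_le_mul fun y z => by simp
  have hH : AbsolutelyContinuousOnInterval (fun s => x₀ + ∫ r in a..s, f r) a b :=
    (hT.lipschitzOnWith (s := univ)).comp_absolutelyContinuousOnInterval hP (mapsTo_univ _ _)
  have hφ := hK.comp_absolutelyContinuousOnInterval hH
    fun s hs => by simpa [mem_closedBall, dist_eq_norm] using hC s hs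
  have key := hφ.integral_deriv_eq_sub
  simp only [intervalIntegral.integral_same, add_zero] at key
  rw [← key]
  refine intervalIntegral.integral_mono_ae_restrict hab hφ.intervalIntegrable_deriv hρ ?_
  rw [Filter.EventuallyLE, ae_restrict_iff' measurableSet_Icc]
  filter_upwards [hf.ae_hasDerivAt_integral] with s hs hsI
  have hd := (hs (by rwa [uIcc_of_le hab]) a left_mem_uIcc).const_add x₀
  have hdV := (hV.differentiable one_ne_zero (x₀ + ∫ r in a..s, f r)).hasFDerivAt
  have hc := hdV.comp_hasDerivAt s hd
  have hc' : deriv (fun s => V (x₀ + ∫ r in a..s, f r)) s = _ := hc.deriv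
  rw [hc']
  exact hle s hsI

/-- Cauchy–Schwarz for integrals of nonnegative functions. -/
lemma integral_mul_le_sqrt_mul_sqrt {α : Type*} [MeasurableSpace α] {μ : Measure α}
    {f g : α → ℝ} (hf0 : 0 ≤ f) (hg0 : 0 ≤ g) (hf : MemLp f 2 μ) (hg : MemLp g 2 μ) :
    ∫ a, f a * g a ∂μ ≤ √(∫ a, f a ^ 2 ∂μ) * √(∫ a, g a ^ 2 ∂μ) := by
  have h := integral_mul_le_Lp_mul_Lq_of_nonneg (μ := μ) Real.HolderConjugate.two_two
    (.of_forall hf0) (.of_forall hg0) (by simpa using hf) (by simpa using hg)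
  simpa [Real.sqrt_eq_rpow] using h

lemma inner_mVec {d m : ℕ} (A : Matrix (Fin d) (Fin m) ℝ) (x : EuclideanSpace ℝ (Fin d))
    (v : EuclideanSpace ℝ (Fin m)) : ⟪x, mVec A v⟫ = ⟪mVecT A x, v⟫ := by
  simp only [PiLp.inner_apply, mVec, mVecT, WithLp.equiv_symm_apply, RCLike.inner_apply,
    conj_trivial, Finset.sum_mul, Finset.mul_sum]
  rw [Finset.sum_comm]
  exact Finset.sum_congr rfl fun j _ => Finset.sum_congr rfl fun i _ => by ring

lemma frobSq_nonneg {d m : ℕ} (A : Matrix (Fin d) (Fin m) ℝ) : 0 ≤ frobSq A :=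
  Finset.sum_nonneg fun _ _ => Finset.sum_nonneg fun _ _ => sq_nonneg _

/-- Primitive of a continuous function evaluated at `‖x‖ ^ 2`: regularity and derivative. -/
lemma contDiff_primitive_norm_sq {E : Type*} [NormedAddCommGroup E] [InnerProductSpace ℝ E]
    {k : ℝ → ℝ} (hk : Continuous k) :
    ContDiff ℝ 1 (fun x : E => ∫ s in (0:ℝ)..‖x‖ ^ 2, k s) ∧
      ∀ x v : E, fderiv ℝ (fun x : E => ∫ s in (0:ℝ)..‖x‖ ^ 2, k s) x v
        = k (‖x‖ ^ 2) * (2 * ⟪x, v⟫) := by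
  have hG : ∀ u, HasDerivAt (fun u => ∫ s in (0:ℝ)..u, k s) (k u) u := fun u =>
    hk.integral_hasStrictDerivAt 0 u |>.hasDerivAt
  have hGC : ContDiff ℝ 1 fun u => ∫ s in (0:ℝ)..u, k s := by
    rw [contDiff_one_iff_deriv]
    refine ⟨fun u => (hG u).differentiableAt, ?_⟩
    rwa [funext fun u => (hG u).deriv]
  refine ⟨hGC.comp (contDiff_norm_sq ℝ), fun x v => ?_⟩
  have h := (hG (‖x‖ ^ 2)).comp_hasFDerivAt x (hasStrictFDerivAt_norm_sq x).hasFDerivAt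
  have h' : fderiv ℝ (fun x : E => ∫ s in (0:ℝ)..‖x‖ ^ 2, k s) x = _ := h.fderiv
  rw [h']
  simp

/-- The pointwise dissipativity estimate supplied by the growth condition. -/
lemma inner_drift_le {d m : ℕ} {x β : EuclideanSpace ℝ (Fin d)} {A : Matrix (Fin d) (Fin m) ℝ}
    {c : ℝ} (hc : max (frobSq A + 2 * ⟪x, β⟫) ‖mVecT A x‖ ≤ c)
    (v : EuclideanSpace ℝ (Fin m)) :
    2 * ⟪x, β + mVec A v⟫ ≤ c + 2 * (c * ‖v‖) := by
  have h1 := (le_max_left _ _).trans hc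
  have h2 := (le_max_right _ _).trans hc
  have h3 : ⟪x, mVec A v⟫ ≤ c * ‖v‖ := by
    rw [inner_mVec]
    exact (real_inner_le_norm _ _).trans (by gcongr)
  rw [inner_add_right]
  linarith [frobSq_nonneg A]

/-- The total control bound `∫₀ᵗ (g + 2 g |l'|) ≤ (1 + 2√α) (∫₀¹ g²)^{1/2}`. -/
lemma integral_growth_control_le {F : Type*} [NormedAddCommGroup F] {g : ℝ → ℝ} {v : ℝ → F}
    {α : ℝ} (hg_nonneg : ∀ t, 0 ≤ g t)
    (hg_int : IntegrableOn (fun t => g t ^ 2) (Icc 0 1))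
    (hv_meas : AEStronglyMeasurable v (volume.restrict (Icc 0 1)))
    (hv_int : IntegrableOn (fun t => ‖v t‖ ^ 2) (Icc 0 1))
    (hα : (∫ t in Icc (0:ℝ) 1, ‖v t‖ ^ 2) ≤ α) :
    IntegrableOn (fun s => g s + 2 * (g s * ‖v s‖)) (Icc 0 1) ∧
      ∀ t ∈ Icc (0:ℝ) 1, ∫ s in (0:ℝ)..t, (g s + 2 * (g s * ‖v s‖))
        ≤ (1 + 2 * √α) * √(∫ s in Icc (0:ℝ) 1, g s ^ 2) := by
  have hgm : AEStronglyMeasurable g (volume.restrict (Icc 0 1)) := by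
    have := Real.continuous_sqrt.comp_aestronglyMeasurable hg_int.aestronglyMeasurable
    simpa [Real.sqrt_sq, hg_nonneg] using this
  have hgL : MemLp g 2 (volume.restrict (Icc (0:ℝ) 1)) :=
    (memLp_two_iff_integrable_sq hgm).2 hg_int
  have hvL : MemLp (fun s => ‖v s‖) 2 (volume.restrict (Icc (0:ℝ) 1)) :=
    (memLp_two_iff_integrable_sq hv_meas.norm).2 hv_int
  have hgI : IntegrableOn g (Icc 0 1) := hgL.integrable one_le_two
  have hgvI : IntegrableOn (fun s => g s * ‖v s‖) (Icc 0 1) := hgL.integrable_mul hvL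
  have hI : IntegrableOn (fun s => g s + 2 * (g s * ‖v s‖)) (Icc 0 1) :=
    hgI.add (hgvI.const_mul 2)
  refine ⟨hI, fun t ht => ?_⟩
  have hg1 : ∫ s in Icc (0:ℝ) 1, g s ≤ √(∫ s in Icc (0:ℝ) 1, g s ^ 2) := by
    simpa using integral_mul_le_sqrt_mul_sqrt hg_nonneg (fun _ => zero_le_one) hgL
      (memLp_const (1 : ℝ))
  have hgv : ∫ s in Icc (0:ℝ) 1, g s * ‖v s‖ ≤ √(∫ s in Icc (0:ℝ) 1, g s ^ 2) * √α :=
    (integral_mul_le_sqrt_mul_sqrt hg_nonneg (fun _ => norm_nonneg _) hgL hvL).trans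
      (by gcongr)
  calc ∫ s in (0:ℝ)..t, (g s + 2 * (g s * ‖v s‖))
      = ∫ s in Ioc 0 t, (g s + 2 * (g s * ‖v s‖)) := intervalIntegral.integral_of_le ht.1
    _ ≤ ∫ s in Icc (0:ℝ) 1, (g s + 2 * (g s * ‖v s‖)) := by
        refine setIntegral_mono_set hI (.of_forall fun s => ?_)
          (Ioc_subset_Icc_self.trans (Icc_subset_Icc_right ht.2)).eventuallyLE
        have := hg_nonneg s
        show 0 ≤ g s + 2 * (g s * ‖v s‖)
        positivity
    _ = (∫ s in Icc (0:ℝ) 1, g s) + 2 * ∫ s in Icc (0:ℝ) 1, g s * ‖v s‖ := by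
        rw [integral_add hgI (hgvI.const_mul 2), integral_const_mul]
    _ ≤ (1 + 2 * √α) * √(∫ s in Icc (0:ℝ) 1, g s ^ 2) := by linarith

/-- under the global growth condition, a quantitative a priori
bound for controlled trajectories:
`∫₀^{|h(t)|²} ds/(γ(s)+1) ≤ ∫₀^{|x₀|²} ds/(γ(s)+1) + (1+2√α)(∫₀¹ g²)^{1/2}`. -/
theorem controlled_trajectories_apriori_bound {d m : ℕ} (hd : 1 ≤ d) (hm : 1 ≤ m)
    (x₀ : EuclideanSpace ℝ (Fin d))
    (b : ℝ → EuclideanSpace ℝ (Fin d) → EuclideanSpace ℝ (Fin d))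
    (σ : ℝ → EuclideanSpace ℝ (Fin d) → Matrix (Fin d) (Fin m) ℝ)
    (hbmeas : Measurable (Function.uncurry b))
    (hσmeas : ∀ i j, Measurable fun p : ℝ × EuclideanSpace ℝ (Fin d) => σ p.1 p.2 i j)
    -- global growth condition
    (g γ : ℝ → ℝ)
    (hg_nonneg : ∀ t, 0 ≤ g t)
    (hg_int : IntegrableOn (fun t => g t ^ 2) (Icc 0 1))
    (hγ_diff : DifferentiableOn ℝ γ (Ici 0))
    (hγ_nonneg : ∀ u ∈ Ici (0:ℝ), 0 ≤ γ u)
    (hγ_deriv : ∀ u ∈ Ici (0:ℝ), 0 ≤ derivWithin γ (Ici 0) u)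
    (hgrowth : ∀ t ∈ Icc (0:ℝ) 1, ∀ x : EuclideanSpace ℝ (Fin d),
      max (frobSq (σ t x) + 2 * ⟪x, b t x⟫) ‖mVecT (σ t x) x‖
        ≤ g t * (γ (‖x‖ ^ 2) + 1)) :
    ∀ α > (0:ℝ), ∀ l' : ℝ → EuclideanSpace ℝ (Fin m), Adm l' →
      (∫ t in Icc (0:ℝ) 1, ‖l' t‖ ^ 2) ≤ α →
      ∀ h : ℝ → EuclideanSpace ℝ (Fin d), IsSol b σ x₀ l' h →
        ∀ t ∈ Icc (0:ℝ) 1,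
          ∫ s in (0:ℝ)..(‖h t‖ ^ 2), 1 / (γ s + 1)
            ≤ (∫ s in (0:ℝ)..(‖x₀‖ ^ 2), 1 / (γ s + 1)) +
              (1 + 2 * Real.sqrt α) * Real.sqrt (∫ s in Icc (0:ℝ) 1, g s ^ 2) := by
  intro α _ l' hl' hα h hh t ht
  set f : ℝ → EuclideanSpace ℝ (Fin d) := fun s => b s (h s) + mVec (σ s (h s)) (l' s) with hf_def
  by_cases hf : IntervalIntegrable f volume 0 t
  swap
  · -- For a non-integrable right-hand side the integral is `0`, so that `h t = x₀`.
    rw [hh.2 t ht, intervalIntegral.integral_undef hf, add_zero]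
    exact le_add_of_nonneg_right (by positivity)
  set k : ℝ → ℝ := fun u => 1 / (γ |u| + 1)
  have hγpos : ∀ u : ℝ, 0 < γ |u| + 1 := fun u => by
    linarith [hγ_nonneg |u| (mem_Ici.2 (abs_nonneg u))]
  have hk : Continuous k :=
    continuous_const.div₀ ((hγ_diff.continuousOn.comp_continuous continuous_abs
      fun u => mem_Ici.2 (abs_nonneg u)).add continuous_const) fun u => (hγpos u).ne'
  have hk_eq : ∀ y : EuclideanSpace ℝ (Fin d),
      ∫ s in (0:ℝ)..‖y‖ ^ 2, 1 / (γ s + 1) = ∫ s in (0:ℝ)..‖y‖ ^ 2, k s := fun y => by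
    refine intervalIntegral.integral_congr fun s hs => ?_
    rw [uIcc_of_le (by positivity)] at hs
    simp only [k, abs_of_nonneg hs.1]
  obtain ⟨hV, hV'⟩ := contDiff_primitive_norm_sq (E := EuclideanSpace ℝ (Fin d)) hk
  obtain ⟨hρ, hρ_le⟩ := integral_growth_control_le hg_nonneg hg_int hl'.1 hl'.2 hα
  have hmain := comp_primitive_sub_le_integral hV (x₀ := x₀) ht.1 hf
    ((intervalIntegrable_iff_integrableOn_Icc_of_le ht.1).2
      (hρ.mono_set (Icc_subset_Icc_right ht.2))) fun s hs => by
    have hs1 : s ∈ Icc (0:ℝ) 1 := ⟨hs.1, hs.2.trans ht.2⟩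
    rw [← hh.2 s hs1, hV']
    have hgr := inner_drift_le (hgrowth s hs1 (h s)) (l' s)
    have hp := hγpos (‖h s‖ ^ 2)
    have habs : |‖h s‖ ^ 2| = ‖h s‖ ^ 2 := abs_of_nonneg (by positivity)
    simp only [k, habs] at hp ⊢
    rw [one_div_mul_eq_div, div_le_iff₀ hp]
    exact hgr.trans_eq (by ring)
  rw [← hh.2 t ht] at hmain
  rw [hk_eq, hk_eq]
  linarith [hρ_le t ht]
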